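/- arXiv:1808.04801 — 2 statements merged into one kernel-verified Lean document; each statement's English description precedes it below -/
import Mathlib

section
/- (Brenier's theorem, existence and uniqueness) Let μ and ν be two compactly supported probability measures on ℝⁿ, and suppose μ is absolutely continuous with respect to Lebesgue measure. Then there is a unique optimal transport map T for the quadratic cost c(x,y) = |x − y|² (i.e., T pushes μ forward to ν and minimizes ∫ |x − T(x)|² dμ(x) among all such maps), and there exists a convex function u : ℝⁿ → ℝ such that T(x) = ∇u(x) for μ-almost every x. -/
open MeasureTheory Set
open scoped ENNReal

noncomputable section

/-- The quadratic transport cost `∫ |x - T(x)|² dμ(x)` of a map `T`. -/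
def quadCost {n : ℕ} (μ : Measure (EuclideanSpace ℝ (Fin n)))
    (T : EuclideanSpace ℝ (Fin n) → EuclideanSpace ℝ (Fin n)) : ℝ≥0∞ :=
  ∫⁻ x, ENNReal.ofReal (‖x - T x‖ ^ 2) ∂μ

/-- `T` is an optimal transport map from `μ` to `ν` for the quadratic cost: it is measurable,
pushes `μ` forward to `ν`, and minimizes `∫ |x - T(x)|² dμ` among all such maps. -/
def IsOptimalMap {n : ℕ} (μ ν : Measure (EuclideanSpace ℝ (Fin n)))
    (T : EuclideanSpace ℝ (Fin n) → EuclideanSpace ℝ (Fin n)) : Prop :=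
  Measurable T ∧ Measure.map T μ = ν ∧
    ∀ S : EuclideanSpace ℝ (Fin n) → EuclideanSpace ℝ (Fin n),
      Measurable S → Measure.map S μ = ν → quadCost μ T ≤ quadCost μ S

section BrenierHelpers

open Filter Topology

variable {E : Type*} [NormedAddCommGroup E] [InnerProductSpace ℝ E] [FiniteDimensional ℝ E]

/-- Legendre transform restricted to the closed ball of radius `R`. -/
def brConj (R : ℝ) (g : E → ℝ) (x : E) : ℝ :=
  sSup ((fun y => inner ℝ x y - g y) '' Metric.closedBall (0 : E) R)

theorem brConj_exists {R : ℝ} (hR : 0 ≤ R) {g : E → ℝ} (hg : Continuous g) (x : E) :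
    ∃ y ∈ Metric.closedBall (0 : E) R, brConj R g x = inner ℝ x y - g y := by
  obtain ⟨y, hy, h, -⟩ := (isCompact_closedBall (0 : E) R).exists_sSup_image_eq_and_ge
    (f := fun y => inner ℝ x y - g y) ⟨0, by simpa using hR⟩ (by fun_prop)
  exact ⟨y, hy, h⟩

theorem brConj_ge {R : ℝ} {g : E → ℝ} (hg : Continuous g) (x : E) {y : E}
    (hy : y ∈ Metric.closedBall (0 : E) R) : inner ℝ x y - g y ≤ brConj R g x := by
  apply le_csSup
  · exact ((isCompact_closedBall (0 : E) R).image (by fun_prop)).bddAbove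
  · exact ⟨y, hy, rfl⟩

theorem brConj_lip {R : ℝ} (hR : 0 ≤ R) {g : E → ℝ} (hg : Continuous g) :
    LipschitzWith R.toNNReal (brConj R g) := by
  apply LipschitzWith.of_le_add_mul
  intro x x'
  obtain ⟨y, hy, h⟩ := brConj_exists hR hg x
  have h1 := brConj_ge hg x' hy
  rw [h, Real.coe_toNNReal _ hR, dist_eq_norm]
  have h2 : inner ℝ (x - x') y ≤ ‖x - x'‖ * ‖y‖ := real_inner_le_norm _ _
  rw [inner_sub_left] at h2
  have h3 : ‖y‖ ≤ R := by simpa using hy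
  have := mul_le_mul_of_nonneg_left h3 (norm_nonneg (x - x'))
  linarith

theorem brConj_cont {R : ℝ} (hR : 0 ≤ R) {g : E → ℝ} (hg : Continuous g) :
    Continuous (brConj R g) := (brConj_lip hR hg).continuous

theorem brConj_convex {R : ℝ} (hR : 0 ≤ R) {g : E → ℝ} (hg : Continuous g) :
    ConvexOn ℝ univ (brConj R g) := by
  refine ⟨convex_univ, ?_⟩
  intro x _ x' _ a b ha hb hab
  obtain ⟨y, hy, h⟩ := brConj_exists hR hg (a • x + b • x')
  have h1 := mul_le_mul_of_nonneg_left (brConj_ge hg x hy) ha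
  have h2 := mul_le_mul_of_nonneg_left (brConj_ge hg x' hy) hb
  rw [h, inner_add_left, inner_smul_left, inner_smul_left]
  simp only [smul_eq_mul, conj_trivial]
  have : g y = a * g y + b * g y := by rw [← add_mul, hab, one_mul]
  linarith

theorem brConj_mono {R : ℝ} (hR : 0 ≤ R) {g g' : E → ℝ} (hg : Continuous g) (hg' : Continuous g')
    {c : ℝ} (h : ∀ y ∈ Metric.closedBall (0 : E) R, g y ≤ g' y + c) (x : E) :
    brConj R g' x ≤ brConj R g x + c := by
  obtain ⟨y, hy, h'⟩ := brConj_exists hR hg' x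
  have := brConj_ge hg x hy
  have := h y hy
  linarith

theorem brConj_conj_le {R : ℝ} (hR : 0 ≤ R) {g : E → ℝ} (hg : Continuous g) {y : E}
    (hy : y ∈ Metric.closedBall (0 : E) R) : brConj R (brConj R g) y ≤ g y := by
  obtain ⟨x, hx, h⟩ := brConj_exists hR (brConj_cont hR hg) y
  have := brConj_ge hg x hy
  rw [h, real_inner_comm]
  linarith

theorem br_compact (K : NNReal) :
    IsCompact {f : C(E, ℝ) | LipschitzWith K f ∧ f 0 = 0} := by
  apply ArzelaAscoli.isCompact_of_equicontinuous
  · have him : (ContinuousMap.toFun '' {f : C(E, ℝ) | LipschitzWith K f ∧ f 0 = 0})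
        = {f : E → ℝ | LipschitzWith K f ∧ f 0 = 0} := by
      ext f
      constructor
      · rintro ⟨g, hg, rfl⟩
        exact hg
      · intro hf
        exact ⟨⟨f, hf.1.continuous⟩, hf, rfl⟩
    rw [him]
    apply IsCompact.of_isClosed_subset
      (isCompact_univ_pi (s := fun x : E => Metric.closedBall (0 : ℝ) (K * dist x 0))
        (fun x => isCompact_closedBall _ _))
    · apply IsClosed.inter
      · exact isClosed_setOfPred_lipschitzWith K
      · exact isClosed_eq (continuous_apply 0) continuous_const
    · intro f hf x _
      have := hf.1.dist_le_mul x 0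
      rwa [hf.2] at this
  · apply UniformEquicontinuous.equicontinuous
    exact LipschitzWith.uniformEquicontinuous _ K (fun f => f.2.1)

variable [MeasurableSpace E] [BorelSpace E]

theorem br_integrable {μ : Measure E} [IsProbabilityMeasure μ] {R : ℝ}
    (hμ : ∀ᵐ x ∂μ, x ∈ Metric.closedBall (0 : E) R) {f : E → ℝ} (hf : Continuous f) :
    Integrable f μ := by
  rw [← Measure.restrict_eq_self_of_ae_mem hμ]
  exact hf.continuousOn.integrableOn_compact (isCompact_closedBall (0 : E) R)

/-- The dual functional. -/
def brF (R : ℝ) (μ ν : Measure E) (g : E → ℝ) : ℝ := ∫ x, brConj R g x ∂μ + ∫ y, g y ∂ν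

theorem brF_conj_conj {R : ℝ} (hR : 0 ≤ R) {μ ν : Measure E} [IsProbabilityMeasure μ] [IsProbabilityMeasure ν]
    (hμ : ∀ᵐ x ∂μ, x ∈ Metric.closedBall (0 : E) R)
    (hν : ∀ᵐ x ∂ν, x ∈ Metric.closedBall (0 : E) R)
    {g : E → ℝ} (hg : Continuous g) :
    brF R μ ν (brConj R (brConj R g)) ≤ brF R μ ν g := by
  have hc := brConj_cont hR hg
  have hcc := brConj_cont hR hc
  have hccc := brConj_cont hR hcc
  apply add_le_add
  · apply integral_mono_ae (br_integrable hμ hccc) (br_integrable hμ hc)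
    filter_upwards [hμ] with x hx using brConj_conj_le hR hc hx
  · apply integral_mono_ae (br_integrable hν hcc) (br_integrable hν hg)
    filter_upwards [hν] with x hx using brConj_conj_le hR hg hx

theorem brF_sub_const {R : ℝ} (hR : 0 ≤ R) {μ ν : Measure E} [IsProbabilityMeasure μ] [IsProbabilityMeasure ν]
    (hμ : ∀ᵐ x ∂μ, x ∈ Metric.closedBall (0 : E) R)
    (hν : ∀ᵐ x ∂ν, x ∈ Metric.closedBall (0 : E) R)
    {g : E → ℝ} (hg : Continuous g) (c : ℝ) :
    brF R μ ν (fun y => g y - c) = brF R μ ν g := by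
  have h : brConj R (fun y => g y - c) = fun x => brConj R g x + c := by
    ext x
    have h1 := brConj_mono hR hg (g' := fun y => g y - c) (by fun_prop) (c := c)
      (fun y _ => by simp) x
    have h2 := brConj_mono hR (g := fun y => g y - c) (g' := g) (by fun_prop) hg (c := -c)
      (fun y _ => by simp [sub_eq_add_neg]) x
    linarith
  unfold brF
  rw [h, integral_add (br_integrable hμ (brConj_cont hR hg)) (by simp),
    integral_sub (br_integrable hν hg) (by simp)]
  simp

theorem brF_le {R : ℝ} (hR : 0 ≤ R) {μ ν : Measure E} [IsProbabilityMeasure μ] [IsProbabilityMeasure ν]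
    (hμ : ∀ᵐ x ∂μ, x ∈ Metric.closedBall (0 : E) R)
    (hν : ∀ᵐ x ∂ν, x ∈ Metric.closedBall (0 : E) R)
    {g g' : E → ℝ} (hg : Continuous g) (hg' : Continuous g') {c : ℝ}
    (h : ∀ y ∈ Metric.closedBall (0 : E) R, |g y - g' y| ≤ c) :
    brF R μ ν g ≤ brF R μ ν g' + 2 * c := by
  have h1 : ∫ x, brConj R g x ∂μ ≤ ∫ x, (brConj R g' x + c) ∂μ := by
    apply integral_mono (br_integrable hμ (brConj_cont hR hg))
      (br_integrable hμ ((brConj_cont hR hg').add continuous_const))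
    intro x
    apply brConj_mono hR hg' hg
    intro y hy
    have := abs_le.1 (h y hy)
    linarith
  have h2 : ∫ x, g x ∂ν ≤ ∫ x, (g' x + c) ∂ν := by
    apply integral_mono_ae (br_integrable hν hg)
      (br_integrable hν (hg'.add continuous_const))
    filter_upwards [hν] with y hy
    have := abs_le.1 (h y hy)
    change g y ≤ g' y + c
    linarith
  rw [integral_add (br_integrable hμ (brConj_cont hR hg')) (by simp)] at h1
  rw [integral_add (br_integrable hν hg') (by simp)] at h2
  simp at h1 h2
  unfold brF
  linarith

theorem brF_min {R : ℝ} (hR : 0 ≤ R) {μ ν : Measure E} [IsProbabilityMeasure μ] [IsProbabilityMeasure ν]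
    (hμ : ∀ᵐ x ∂μ, x ∈ Metric.closedBall (0 : E) R)
    (hν : ∀ᵐ x ∂ν, x ∈ Metric.closedBall (0 : E) R)
    : ∃ g : E → ℝ, Continuous g ∧
    ∀ g' : E → ℝ, Continuous g' → brF R μ ν g ≤ brF R μ ν g' := by
  have hcont : Continuous (fun f : C(E, ℝ) => brF R μ ν f) := by
    rw [continuous_iff_continuousAt]
    intro f
    have h := ContinuousMap.tendsto_iff_forall_isCompact_tendstoUniformlyOn.1
      (tendsto_id (α := C(E, ℝ)) (x := 𝓝 f)) _ (isCompact_closedBall (0 : E) R)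
    rw [Metric.tendstoUniformlyOn_iff] at h
    rw [ContinuousAt, Metric.tendsto_nhds]
    intro ε hε
    filter_upwards [h (ε / 4) (by positivity)] with f' hf'
    have h1 : ∀ y ∈ Metric.closedBall (0 : E) R, |f y - f' y| ≤ ε / 4 := by
      intro y hy
      have := (hf' y hy).le
      rwa [Real.dist_eq] at this
    have h2 := brF_le hR hμ hν f.continuous f'.continuous h1
    have h3 := brF_le hR hμ hν f'.continuous f.continuous
      (fun y hy => by rw [abs_sub_comm]; exact h1 y hy)
    rw [Real.dist_eq, abs_lt]
    constructor <;> linarith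
  obtain ⟨f, hf, hmin⟩ := (br_compact (E := E) R.toNNReal).exists_isMinOn
    ⟨0, LipschitzWith.const' (K := R.toNNReal) (0 : ℝ), rfl⟩ hcont.continuousOn
  refine ⟨f, f.continuous, fun g' hg' => ?_⟩
  have hc := brConj_cont hR hg'
  have hl := brConj_lip hR hc
  refine le_trans ?_ (brF_conj_conj hR hμ hν hg')
  rw [← brF_sub_const hR hμ hν hl.continuous (brConj R (brConj R g') 0)]
  refine hmin (a := ⟨_, hl.continuous.sub continuous_const⟩) ⟨?_, by simp⟩
  apply LipschitzWith.of_dist_le_mul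
  intro x y
  simpa using hl.dist_le_mul x y

theorem br_grad {R : ℝ} {g : E → ℝ} (hg : Continuous g) {x y : E}
    (hd : DifferentiableAt ℝ (brConj R g) x) (hy : y ∈ Metric.closedBall (0 : E) R)
    (h : brConj R g x = inner ℝ x y - g y) : y = gradient (brConj R g) x := by
  have hmin : IsLocalMin (fun z => brConj R g z - inner ℝ y z) x := by
    apply Filter.Eventually.of_forall
    intro z
    have := brConj_ge hg z hy
    have e1 := real_inner_comm y z
    have e2 := real_inner_comm y x
    simp only
    linarith
  have hd1 : HasFDerivAt (fun z => inner ℝ y z) (innerSL ℝ y) x := (innerSL ℝ y).hasFDerivAt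
  have h0 := hmin.hasFDerivAt_eq_zero (hd.hasFDerivAt.sub hd1)
  rw [sub_eq_zero] at h0
  unfold gradient
  rw [h0, LinearIsometryEquiv.eq_symm_apply]
  rfl

/-- Envelope theorem. -/
theorem br_envelope {R : ℝ} (hR : 0 ≤ R) {g h : E → ℝ} (hg : Continuous g) (hh : Continuous h)
    {C : ℝ} (hC : ∀ y, |h y| ≤ C) {x : E} (hd : DifferentiableAt ℝ (brConj R g) x) :
    Tendsto (fun k : ℕ => ((k : ℝ) + 1) *
      (brConj R (fun y => g y + ((k : ℝ) + 1)⁻¹ * h y) x - brConj R g x)) atTop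
      (𝓝 (- h (gradient (brConj R g) x))) := by
  obtain ⟨y₀, hy₀, h₀⟩ := brConj_exists hR hg x
  have hgr := br_grad hg hd hy₀ h₀
  rw [← hgr]
  have hct : ∀ k : ℕ, Continuous (fun y => g y + ((k : ℝ) + 1)⁻¹ * h y) := fun k => by fun_prop
  rw [Metric.tendsto_nhds]
  intro ε hε
  -- gap outside the neighbourhood
  have hgap : ∃ δ > 0, ∀ y ∈ Metric.closedBall (0 : E) R, h y ≤ h y₀ - ε / 2 →
      inner ℝ x y - g y ≤ brConj R g x - δ := by
    have hcpt : IsCompact (Metric.closedBall (0 : E) R ∩ {y | h y ≤ h y₀ - ε / 2}) :=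
      (isCompact_closedBall (0 : E) R).inter_right (isClosed_le hh continuous_const)
    rcases (Metric.closedBall (0 : E) R ∩ {y | h y ≤ h y₀ - ε / 2}).eq_empty_or_nonempty with
      he | hne
    · refine ⟨1, one_pos, fun y hy hy' => ?_⟩
      have : y ∈ (Metric.closedBall (0 : E) R ∩ {y | h y ≤ h y₀ - ε / 2}) := ⟨hy, hy'⟩
      rw [he] at this
      exact this.elim
    · obtain ⟨z, hz, hmax⟩ := hcpt.exists_isMaxOn hne
        (f := fun y => inner ℝ x y - g y) (by fun_prop)
      refine ⟨brConj R g x - (inner ℝ x z - g z), ?_, fun y hy hy' => ?_⟩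
      · have hle := brConj_ge hg x hz.1
        rcases hle.lt_or_eq with hlt | heq
        · linarith
        · exfalso
          have := br_grad hg hd hz.1 heq.symm
          have hz2 : h z ≤ h y₀ - ε / 2 := hz.2
          rw [this, ← hgr] at hz2
          linarith
      · have : inner ℝ x y - g y ≤ inner ℝ x z - g z := hmax ⟨hy, hy'⟩
        linarith
  obtain ⟨δ, hδ, hgap⟩ := hgap
  obtain ⟨N, hN⟩ := exists_nat_gt (2 * C / δ)
  filter_upwards [eventually_ge_atTop N] with k hk
  have hk1 : (0 : ℝ) < (k : ℝ) + 1 := by positivity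
  have hkN : (N : ℝ) ≤ k := by exact_mod_cast hk
  set t : ℝ := ((k : ℝ) + 1)⁻¹ with ht
  have htpos : 0 < t := by positivity
  have hkt : ((k : ℝ) + 1) * t = 1 := mul_inv_cancel₀ hk1.ne'
  have htC : t * (2 * C) ≤ δ := by
    rw [div_lt_iff₀ hδ] at hN
    have : 2 * C ≤ ((k : ℝ) + 1) * δ := by nlinarith
    calc t * (2 * C) ≤ t * (((k : ℝ) + 1) * δ) := by gcongr
      _ = (((k : ℝ) + 1) * t) * δ := by ring
      _ = δ := by rw [hkt, one_mul]
  have hlow := brConj_ge (hct k) x hy₀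
  obtain ⟨y, hy, hup⟩ := brConj_exists hR (hct k) x
  simp only [← ht] at hlow hup
  have hup2 : brConj R (fun y => g y + t * h y) x ≤ brConj R g x + t * (- h y₀ + ε / 2) := by
    by_cases hc : h y ≤ h y₀ - ε / 2
    · have h1 := hgap y hy hc
      have h2 := abs_le.1 (hC y)
      have h3 := abs_le.1 (hC y₀)
      have : t * (h y₀ - h y) ≤ t * (2 * C) := by gcongr; linarith
      have : 0 ≤ t * (ε / 2) := by positivity
      rw [hup]
      linarith
    · push Not at hc
      have h1 := brConj_ge hg x hy
      have : t * (h y₀ - ε / 2) ≤ t * h y := by gcongr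
      rw [hup]
      linarith
  have hA : ((k : ℝ) + 1) * (brConj R (fun y => g y + t * h y) x - brConj R g x)
      ≤ - h y₀ + ε / 2 := by
    calc _ ≤ ((k : ℝ) + 1) * (t * (- h y₀ + ε / 2)) := by gcongr; linarith
      _ = (((k : ℝ) + 1) * t) * (- h y₀ + ε / 2) := by ring
      _ = _ := by rw [hkt, one_mul]
  have hB : - h y₀ ≤
      ((k : ℝ) + 1) * (brConj R (fun y => g y + t * h y) x - brConj R g x) := by
    calc _ = (((k : ℝ) + 1) * t) * (- h y₀) := by rw [hkt, one_mul]
      _ = ((k : ℝ) + 1) * (t * (- h y₀)) := by ring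
      _ ≤ _ := by gcongr; linarith
  rw [Real.dist_eq, abs_lt]
  constructor <;> linarith

theorem br_meas_grad (f : E → ℝ) : Measurable (gradient f) := by
  unfold gradient
  exact (InnerProductSpace.toDual ℝ E).symm.continuous.measurable.comp (measurable_fderiv ℝ f)

theorem br_push_le {R : ℝ} (hR : 0 ≤ R) {μ ν : Measure E} [IsProbabilityMeasure μ] [IsProbabilityMeasure ν]
    (hμ : ∀ᵐ x ∂μ, x ∈ Metric.closedBall (0 : E) R)
    (hν : ∀ᵐ x ∂ν, x ∈ Metric.closedBall (0 : E) R)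
    {g : E → ℝ} (hg : Continuous g)
    (hmin : ∀ g' : E → ℝ, Continuous g' → brF R μ ν g ≤ brF R μ ν g')
    (hdiff : ∀ᵐ x ∂μ, DifferentiableAt ℝ (brConj R g) x)
    {h : E → ℝ} (hh : Continuous h) {C : ℝ} (hC : ∀ y, |h y| ≤ C) :
    ∫ x, h (gradient (brConj R g) x) ∂μ ≤ ∫ y, h y ∂ν := by
  have hct : ∀ k : ℕ, Continuous (fun y => g y + ((k : ℝ) + 1)⁻¹ * h y) := fun k => by fun_prop
  have hcc := fun k => brConj_cont hR (hct k)
  have hgc := brConj_cont hR hg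
  have hlim : Tendsto (fun k : ℕ => ∫ x, ((k : ℝ) + 1) *
      (brConj R (fun y => g y + ((k : ℝ) + 1)⁻¹ * h y) x - brConj R g x) ∂μ) atTop
      (𝓝 (∫ x, - h (gradient (brConj R g) x) ∂μ)) := by
    apply tendsto_integral_of_dominated_convergence (fun _ => C)
    · intro k
      exact (continuous_const.mul ((hcc k).sub hgc)).aestronglyMeasurable
    · simp
    · intro k
      apply Eventually.of_forall
      intro x
      have hk1 : (0 : ℝ) < (k : ℝ) + 1 := by positivity
      have htpos : 0 < ((k : ℝ) + 1)⁻¹ := by positivity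
      have h1 := brConj_mono hR hg (hct k) (c := ((k : ℝ) + 1)⁻¹ * C) (fun y _ => by
        have := mul_le_mul_of_nonneg_left (abs_le.1 (hC y)).1 htpos.le
        linarith) x
      have h2 := brConj_mono hR (hct k) hg (c := ((k : ℝ) + 1)⁻¹ * C) (fun y _ => by
        have := mul_le_mul_of_nonneg_left (abs_le.1 (hC y)).2 htpos.le
        linarith) x
      rw [Real.norm_eq_abs, abs_mul, abs_of_pos hk1, ← le_div_iff₀' hk1, div_eq_inv_mul, abs_le]
      constructor <;> linarith
    · filter_upwards [hdiff] with x hx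
      exact br_envelope hR hg hh hC hx
  rw [integral_neg] at hlim
  have : - ∫ y, h y ∂ν ≤ - ∫ x, h (gradient (brConj R g) x) ∂μ := by
    apply ge_of_tendsto' hlim
    intro k
    have hk1 : (0 : ℝ) < (k : ℝ) + 1 := by positivity
    have h1 := hmin _ (hct k)
    unfold brF at h1
    rw [integral_add (br_integrable hν hg) (br_integrable hν (by fun_prop)),
      integral_const_mul] at h1
    rw [integral_const_mul, integral_sub (br_integrable hμ (hcc k)) (br_integrable hμ hgc)]
    have h2 : ((k : ℝ) + 1)⁻¹ * (- ∫ y, h y ∂ν) ≤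
      ∫ x, brConj R (fun y => g y + ((k : ℝ) + 1)⁻¹ * h y) x ∂μ - ∫ x, brConj R g x ∂μ := by
      linarith
    rwa [inv_mul_le_iff₀ hk1] at h2
  linarith

theorem br_push {R : ℝ} (hR : 0 ≤ R) {μ ν : Measure E} [IsProbabilityMeasure μ] [IsProbabilityMeasure ν]
    (hμ : ∀ᵐ x ∂μ, x ∈ Metric.closedBall (0 : E) R)
    (hν : ∀ᵐ x ∂ν, x ∈ Metric.closedBall (0 : E) R)
    {g : E → ℝ} (hg : Continuous g)
    (hmin : ∀ g' : E → ℝ, Continuous g' → brF R μ ν g ≤ brF R μ ν g')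
    (hdiff : ∀ᵐ x ∂μ, DifferentiableAt ℝ (brConj R g) x)
    : Measure.map (gradient (brConj R g)) μ = ν := by
  have hm := br_meas_grad (brConj R g)
  have := Measure.isProbabilityMeasure_map (μ := μ) hm.aemeasurable
  apply ext_of_forall_integral_eq_of_IsFiniteMeasure
  intro f
  rw [integral_map hm.aemeasurable f.continuous.aestronglyMeasurable]
  have hb : ∀ y, |f y| ≤ ‖f‖ := fun y => f.norm_coe_le_norm y
  apply le_antisymm
  · exact br_push_le hR hμ hν hg hmin hdiff f.continuous hb
  · have := br_push_le hR hμ hν hg hmin hdiff (h := fun y => - f y) (by fun_prop)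
      (C := ‖f‖) (fun y => by rw [abs_neg]; exact hb y)
    rw [integral_neg, integral_neg] at this
    linarith

/-- Cost as a real number in terms of the correlation. -/
theorem br_cost {R : ℝ} {μ ν : Measure E} [IsProbabilityMeasure μ] [IsProbabilityMeasure ν]
    (hμ : ∀ᵐ x ∂μ, x ∈ Metric.closedBall (0 : E) R)
    (hν : ∀ᵐ x ∂ν, x ∈ Metric.closedBall (0 : E) R)
    {S : E → E} (hS : Measurable S) (hmap : Measure.map S μ = ν) :
    Integrable (fun x => inner ℝ x (S x)) μ ∧
    ∫⁻ x, ENNReal.ofReal (‖x - S x‖ ^ 2) ∂μ = ENNReal.ofReal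
      (∫ x, ‖x‖ ^ 2 ∂μ + ∫ y, ‖y‖ ^ 2 ∂ν - 2 * ∫ x, inner ℝ x (S x) ∂μ) ∧
    0 ≤ ∫ x, ‖x‖ ^ 2 ∂μ + ∫ y, ‖y‖ ^ 2 ∂ν - 2 * ∫ x, inner ℝ x (S x) ∂μ := by
  have hSR : ∀ᵐ x ∂μ, S x ∈ Metric.closedBall (0 : E) R := by
    rw [← hmap] at hν
    exact ae_of_ae_map hS.aemeasurable hν
  have i1 : Integrable (fun x => inner ℝ x (S x)) μ := by
    apply Integrable.of_bound (C := R * R) (by fun_prop)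
    filter_upwards [hμ, hSR] with x h1 h2
    have h1 : ‖x‖ ≤ R := by simpa using h1
    have h2 : ‖S x‖ ≤ R := by simpa using h2
    refine (norm_inner_le_norm x (S x)).trans ?_
    gcongr
    exact (norm_nonneg x).trans h1
  have i2 : Integrable (fun x : E => ‖x‖ ^ 2) μ := br_integrable hμ (by fun_prop)
  have i3 : Integrable (fun x : E => ‖x‖ ^ 2) ν := br_integrable hν (by fun_prop)
  have i4 : Integrable (fun x : E => ‖S x‖ ^ 2) μ := by
    rw [← hmap] at i3
    exact i3.comp_measurable hS
  have e4 : ∫ y, ‖y‖ ^ 2 ∂ν = ∫ x, ‖S x‖ ^ 2 ∂μ := by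
    rw [← hmap, integral_map hS.aemeasurable (by fun_prop)]
  have heq : (fun x : E => ‖x - S x‖ ^ 2) =
      fun x => ‖x‖ ^ 2 + ‖S x‖ ^ 2 - 2 * inner ℝ x (S x) := by
    ext x
    rw [norm_sub_sq_real]
    ring
  have i6 : Integrable (fun x : E => ‖x‖ ^ 2 + ‖S x‖ ^ 2) μ := i2.add i4
  have i5 : Integrable (fun x : E => ‖x - S x‖ ^ 2) μ := by
    rw [heq]
    exact (i2.add i4).sub (i1.const_mul 2)
  have e5 : ∫ x, ‖x - S x‖ ^ 2 ∂μ =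
      ∫ x, ‖x‖ ^ 2 ∂μ + ∫ y, ‖y‖ ^ 2 ∂ν - 2 * ∫ x, inner ℝ x (S x) ∂μ := by
    rw [heq, integral_sub i6 (i1.const_mul 2), integral_add i2 i4, e4,
      integral_const_mul]
  refine ⟨i1, ?_, ?_⟩
  · rw [← e5, ofReal_integral_eq_lintegral_ofReal i5]
    exact Eventually.of_forall fun x => by positivity
  · rw [← e5]
    exact integral_nonneg fun x => by positivity

end BrenierHelpers

/-- **Brenier's theorem (existence and uniqueness).** Let `μ` and `ν` be compactly supported
probability measures on `ℝⁿ` with `μ` absolutely continuous with respect to Lebesgue measure.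
Then there is an optimal transport map `T` for the quadratic cost, unique up to `μ`-null sets,
and a convex function `u : ℝⁿ → ℝ` such that `T(x) = ∇u(x)` for `μ`-almost every `x`. -/
theorem brenier_existence_uniqueness {n : ℕ}
    (μ ν : Measure (EuclideanSpace ℝ (Fin n)))
    [IsProbabilityMeasure μ] [IsProbabilityMeasure ν]
    (hμsupp : ∃ K : Set (EuclideanSpace ℝ (Fin n)), IsCompact K ∧ μ Kᶜ = 0)
    (hνsupp : ∃ K : Set (EuclideanSpace ℝ (Fin n)), IsCompact K ∧ ν Kᶜ = 0)
    (hac : μ ≪ volume) :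
    ∃ T : EuclideanSpace ℝ (Fin n) → EuclideanSpace ℝ (Fin n),
      IsOptimalMap μ ν T ∧
      (∀ T' : EuclideanSpace ℝ (Fin n) → EuclideanSpace ℝ (Fin n),
        IsOptimalMap μ ν T' → T' =ᵐ[μ] T) ∧
      ∃ u : EuclideanSpace ℝ (Fin n) → ℝ,
        ConvexOn ℝ univ u ∧
        ∀ᵐ x ∂μ, DifferentiableAt ℝ u x ∧ T x = gradient u x := by
  obtain ⟨K, hK, hμK⟩ := hμsupp
  obtain ⟨L, hL, hνL⟩ := hνsupp
  obtain ⟨R, hR, hKL⟩ : ∃ R : ℝ, 0 ≤ R ∧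
      K ∪ L ⊆ Metric.closedBall (0 : EuclideanSpace ℝ (Fin n)) R := by
    obtain ⟨r, hr⟩ := (hK.union hL).isBounded.subset_closedBall
      (0 : EuclideanSpace ℝ (Fin n))
    exact ⟨max r 0, le_max_right _ _, hr.trans (Metric.closedBall_subset_closedBall
      (le_max_left _ _))⟩
  have hμ : ∀ᵐ x ∂μ, x ∈ Metric.closedBall (0 : EuclideanSpace ℝ (Fin n)) R := by
    have : ∀ᵐ x ∂μ, x ∈ K := hμK
    filter_upwards [this] with x hx using hKL (Or.inl hx)
  have hν : ∀ᵐ x ∂ν, x ∈ Metric.closedBall (0 : EuclideanSpace ℝ (Fin n)) R := by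
    have : ∀ᵐ x ∂ν, x ∈ L := hνL
    filter_upwards [this] with x hx using hKL (Or.inr hx)
  obtain ⟨g, hg, hmin⟩ := brF_min hR hμ hν
  have hdiff : ∀ᵐ x ∂μ, DifferentiableAt ℝ (brConj R g) x :=
    hac.ae_le (brConj_lip hR hg).ae_differentiableAt
  have hTm := br_meas_grad (brConj R g)
  have hpush := br_push hR hμ hν hg hmin hdiff
  set T := gradient (brConj R g) with hT
  have hTeq : ∀ᵐ x ∂μ, inner ℝ x (T x) = brConj R g x + g (T x) := by
    filter_upwards [hdiff] with x hx
    obtain ⟨y, hy, h⟩ := brConj_exists hR hg x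
    have := br_grad hg hx hy h
    rw [hT, ← this, h]
    ring
  have hgi : Integrable g ν := br_integrable hν hg
  have hφi : Integrable (brConj R g) μ := br_integrable hμ (brConj_cont hR hg)
  have hSi : ∀ S : EuclideanSpace ℝ (Fin n) → EuclideanSpace ℝ (Fin n), Measurable S →
      Measure.map S μ = ν → Integrable (fun x => brConj R g x + g (S x)) μ ∧
        ∫ x, (brConj R g x + g (S x)) ∂μ = brF R μ ν g := by
    intro S hS hm
    have hgS : Integrable (fun x => g (S x)) μ := by
      rw [← hm] at hgi
      exact hgi.comp_measurable hS
    refine ⟨hφi.add hgS, ?_⟩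
    rw [integral_add hφi hgS, brF, ← hm,
      integral_map hS.aemeasurable hg.aestronglyMeasurable]
  have hTint : ∫ x, inner ℝ x (T x) ∂μ = brF R μ ν g := by
    rw [integral_congr_ae hTeq, (hSi T hTm hpush).2]
  have hSle : ∀ S : EuclideanSpace ℝ (Fin n) → EuclideanSpace ℝ (Fin n), Measurable S →
      Measure.map S μ = ν → ∀ᵐ x ∂μ, S x ∈ Metric.closedBall 0 R ∧
        inner ℝ x (S x) ≤ brConj R g x + g (S x) := by
    intro S hS hm
    rw [← hm] at hν
    filter_upwards [ae_of_ae_map hS.aemeasurable hν] with x hx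
    have := brConj_ge hg x hx
    exact ⟨hx, by linarith⟩
  obtain ⟨hTi, hTc, hTpos⟩ := br_cost hμ hν hTm hpush
  have hopt : IsOptimalMap μ ν T := by
    refine ⟨hTm, hpush, fun S hS hm => ?_⟩
    obtain ⟨hSint, hSc, -⟩ := br_cost hμ hν hS hm
    unfold quadCost
    rw [hTc, hSc]
    apply ENNReal.ofReal_le_ofReal
    have : ∫ x, inner ℝ x (S x) ∂μ ≤ brF R μ ν g := by
      rw [← (hSi S hS hm).2]
      apply integral_mono_ae hSint (hSi S hS hm).1
      filter_upwards [hSle S hS hm] with x hx using hx.2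
    linarith
  refine ⟨T, hopt, ?_, brConj R g, brConj_convex hR hg, ?_⟩
  · rintro S ⟨hS, hm, hSopt⟩
    obtain ⟨hSint, hSc, hSpos⟩ := br_cost hμ hν hS hm
    have h1 := hSopt T hTm hpush
    unfold quadCost at h1
    rw [hTc, hSc, ENNReal.ofReal_le_ofReal_iff hTpos] at h1
    have h2 : ∫ x, (brConj R g x + g (S x)) ∂μ ≤ ∫ x, inner ℝ x (S x) ∂μ := by
      rw [(hSi S hS hm).2]
      linarith
    have hle : (fun x => inner ℝ x (S x)) ≤ᵐ[μ] fun x => brConj R g x + g (S x) := by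
      filter_upwards [hSle S hS hm] with x hx using hx.2
    have h3 := (integral_eq_iff_of_ae_le hSint (hSi S hS hm).1 hle).1
      (le_antisymm (integral_mono_ae hSint (hSi S hS hm).1 hle) h2)
    filter_upwards [h3, hSle S hS hm, hdiff] with x hx hx2 hx3
    exact br_grad hg hx3 hx2.1 (by linarith)
  · filter_upwards [hdiff] with x hx using ⟨hx, rfl⟩
end
end

section
/- (Insensitivity of the squared Wasserstein metric to mean-zero noise) Let f be a probability density on the interval [0,1], bounded away from zero, and for N ∈ ℕ⁺ partition [0,1] into N equal subintervals. Let f_ns = (f + r)/∫(f + r), where the noise r is piecewise constant on the N subintervals with values r₁, …, r_N drawn i.i.d. from a mean-zero uniform distribution on [−c, c] (with c chosen so that f + r ≥ 0). Then the expected squared quadratic Wasserstein distance satisfies E[W₂²(f, f_ns)] = O(1/N) as N → ∞; i.e., there is a constant C (depending on f and c but not on N) with E[W₂²(f, f_ns)] ≤ C/N for all N. -/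
open MeasureTheory Set
open scoped ENNReal

noncomputable section

/-- The measure `f(x) dx` with density `f` with respect to Lebesgue measure on `ℝ`. -/
def densMeasure (f : ℝ → ℝ) : Measure ℝ :=
  volume.withDensity fun x => ENNReal.ofReal (f x)

/-- The squared quadratic Wasserstein distance between densities `f` and `g` on `ℝ`:
the infimum of `∫ |x - T(x)|² f(x) dx` over all measurable maps `T` pushing `f(x)dx`
forward to `g(y)dy`. -/
def W2sq (f g : ℝ → ℝ) : ℝ≥0∞ :=
  sInf {c : ℝ≥0∞ | ∃ T : ℝ → ℝ, Measurable T ∧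
    Measure.map T (densMeasure f) = densMeasure g ∧
    c = ∫⁻ x, ENNReal.ofReal (|x - T x| ^ 2) ∂(densMeasure f)}

/-- The piecewise-constant noise on `[0,1)` determined by the values `r : Fin N → ℝ` on the
`N` equal subintervals `[k/N, (k+1)/N)`, and vanishing outside `[0,1)`. -/
def noiseFun (N : ℕ) (hN : 0 < N) (r : Fin N → ℝ) (x : ℝ) : ℝ :=
  (Ico (0 : ℝ) 1).indicator (fun y => r ⟨⌊(N : ℝ) * y⌋₊ % N, Nat.mod_lt _ hN⟩) x

/-- The noisy density `f_ns = (f + r) / ∫ (f + r)`. -/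
def noisyDensity (f : ℝ → ℝ) (N : ℕ) (hN : 0 < N) (r : Fin N → ℝ) (x : ℝ) : ℝ :=
  (f x + noiseFun N hN r x) / ∫ y, (f y + noiseFun N hN r y)

/-- The uniform probability distribution on `[-c, c]`. -/
def unifMeasure (c : ℝ) : Measure ℝ :=
  (ENNReal.ofReal (2 * c))⁻¹ • volume.restrict (Icc (-c) c)

/-- `g` is a probability density supported on `[0,1]`. -/
structure IsDens (g : ℝ → ℝ) : Prop where
  meas : Measurable g
  nonneg : ∀ x, 0 ≤ g x
  supp : ∀ x, x ∉ Icc (0 : ℝ) 1 → g x = 0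
  int : Integrable g
  mass : ∫ x, g x = 1

/-- The primitive from `0`. -/
def prim (g : ℝ → ℝ) (z : ℝ) : ℝ := ∫ y in (0 : ℝ)..z, g y

lemma prim_cont {g : ℝ → ℝ} (h : Integrable g) : Continuous (prim g) :=
  intervalIntegral.continuous_primitive (fun _ _ => h.intervalIntegrable) 0

lemma prim_sub {g : ℝ → ℝ} (h : Integrable g) (a b : ℝ) :
    prim g b - prim g a = ∫ y in a..b, g y := by
  unfold prim
  rw [intervalIntegral.integral_interval_sub_left h.intervalIntegrable h.intervalIntegrable]

lemma IsDens.mono {g : ℝ → ℝ} (h : IsDens g) : Monotone (prim g) := by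
  intro a b hab
  have := intervalIntegral.integral_nonneg (μ := volume) hab (fun u _ => h.nonneg u)
  rw [← prim_sub h.int] at this
  linarith

lemma prim_eq_one {g : ℝ → ℝ} (hs : ∀ x, x ∉ Icc (0 : ℝ) 1 → g x = 0) {z : ℝ} (hz : 1 ≤ z) :
    prim g z = ∫ x, g x := by
  unfold prim
  rw [intervalIntegral.integral_of_le (by linarith), ← integral_Icc_eq_integral_Ioc]
  apply setIntegral_eq_integral_of_forall_compl_eq_zero
  intro x hx
  apply hs
  intro h
  exact hx ⟨h.1, h.2.trans hz⟩

lemma IsDens.measure_Iic {g : ℝ → ℝ} (h : IsDens g) {z : ℝ} (hz : 0 ≤ z) :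
    densMeasure g (Iic z) = ENNReal.ofReal (prim g z) := by
  unfold densMeasure prim
  rw [withDensity_apply _ measurableSet_Iic,
    ← ofReal_integral_eq_lintegral_ofReal h.int.integrableOn (ae_of_all _ h.nonneg),
    intervalIntegral.integral_of_le hz, ← integral_Icc_eq_integral_Ioc]
  congr 1
  apply setIntegral_eq_of_subset_of_forall_sdiff_eq_zero measurableSet_Iic
    (fun x hx => hx.2)
  intro x hx
  apply h.supp
  intro h'
  exact hx.2 ⟨h'.1, hx.1⟩

lemma IsDens.ae_mem {g : ℝ → ℝ} (h : IsDens g) : ∀ᵐ x ∂(densMeasure g), x ∈ Icc (0:ℝ) 1 := by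
  unfold densMeasure
  rw [ae_withDensity_iff h.meas.ennreal_ofReal]
  refine ae_of_all _ fun x hx => ?_
  by_contra hc
  exact hx (by simp [h.supp x hc])

lemma IsDens.prob {g : ℝ → ℝ} (h : IsDens g) : IsProbabilityMeasure (densMeasure g) := by
  constructor
  unfold densMeasure
  rw [withDensity_apply _ MeasurableSet.univ, Measure.restrict_univ,
    ← ofReal_integral_eq_lintegral_ofReal h.int (ae_of_all _ h.nonneg), h.mass]
  simp

lemma IsDens.exists_prim {g : ℝ → ℝ} (h : IsDens g) {u : ℝ} (h0 : 0 ≤ u) (h1 : u ≤ 1) :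
    ∃ w ∈ Icc (0:ℝ) 1, prim g w = u := by
  have := intermediate_value_Icc (zero_le_one (α := ℝ)) (prim_cont h.int).continuousOn
  rw [prim_eq_one h.supp le_rfl, h.mass] at this
  exact this (by constructor <;> simp [prim, h0, h1])

lemma IsDens.prim_le_one {g : ℝ → ℝ} (h : IsDens g) (x : ℝ) : prim g x ≤ 1 := by
  rw [← h.mass, ← prim_eq_one h.supp (le_max_right x 1)]
  exact h.mono (le_max_left _ _)

lemma IsDens.prim_nonneg {g : ℝ → ℝ} (h : IsDens g) {x : ℝ} (hx : 0 ≤ x) : 0 ≤ prim g x := by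
  have := h.mono hx
  simpa [prim] using this

lemma prim_lower {f : ℝ → ℝ} (h : IsDens f) {δ : ℝ} (hlb : ∀ x ∈ Icc (0 : ℝ) 1, δ ≤ f x)
    {a b : ℝ} (ha : 0 ≤ a) (hab : a ≤ b) (hb : b ≤ 1) : δ * (b - a) ≤ prim f b - prim f a := by
  rw [prim_sub h.int]
  have := intervalIntegral.integral_mono_on (μ := volume) hab (f := fun _ => δ) (g := f)
    (by simp) h.int.intervalIntegrable (fun x hx => hlb x ⟨ha.trans hx.1, hx.2.trans hb⟩)
  simp only [intervalIntegral.integral_const, smul_eq_mul] at this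
  linarith

lemma transport {f g : ℝ → ℝ} (hf : IsDens f) (hg : IsDens g) {δ : ℝ} (hδ : 0 < δ)
    (hlb : ∀ x ∈ Icc (0 : ℝ) 1, δ ≤ f x) :
    W2sq f g ≤ 1 ∧ W2sq f g ≤
      ∫⁻ z, ENNReal.ofReal ((δ⁻¹ * (prim g z - prim f z)) ^ 2) ∂(densMeasure g) := by
  have := hf.prob
  have := hg.prob
  set T : ℝ → ℝ := fun x => sInf {z | 0 ≤ z ∧ prim f x ≤ prim g z} with hT
  have hbdd : ∀ x, BddBelow {z | 0 ≤ z ∧ prim f x ≤ prim g z} := fun x => ⟨0, fun z hz => hz.1⟩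
  have h1mem : ∀ x, (1:ℝ) ∈ {z | 0 ≤ z ∧ prim f x ≤ prim g z} := fun x => by
    refine ⟨zero_le_one, ?_⟩
    rw [prim_eq_one hg.supp le_rfl, hg.mass]
    exact hf.prim_le_one x
  have hTmem : ∀ x, T x ∈ {z | 0 ≤ z ∧ prim f x ≤ prim g z} := fun x => by
    refine IsClosed.csInf_mem ?_ ⟨1, h1mem x⟩ (hbdd x)
    exact isClosed_Ici.inter (isClosed_le continuous_const (prim_cont hg.int))
  have hTle1 : ∀ x, T x ≤ 1 := fun x => csInf_le (hbdd x) (h1mem x)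
  have hTle : ∀ x z, 0 ≤ z → (T x ≤ z ↔ prim f x ≤ prim g z) := fun x z hz =>
    ⟨fun h => (hTmem x).2.trans (hg.mono h), fun h => csInf_le (hbdd x) ⟨hz, h⟩⟩
  have hTmono : Monotone T := fun x y hxy =>
    (hTle x (T y) (hTmem y).1).2 ((hf.mono hxy).trans (hTmem y).2)
  have hTmeas : Measurable T := hTmono.measurable
  have hmap : Measure.map T (densMeasure f) = densMeasure g := by
    have : IsProbabilityMeasure (Measure.map T (densMeasure f)) :=
      Measure.isProbabilityMeasure_map hTmeas.aemeasurable
    apply Measure.ext_of_Iic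
    intro z
    rw [Measure.map_apply hTmeas measurableSet_Iic]
    rcases lt_or_ge z 0 with hz | hz
    · have e1 : T ⁻¹' Iic z = ∅ := by
        ext x
        simp only [mem_preimage, mem_Iic, mem_empty_iff_false, iff_false, not_le]
        exact hz.trans_le (hTmem x).1
      rw [e1, measure_empty]
      symm
      have := hg.ae_mem
      rw [ae_iff] at this
      refine measure_mono_null ?_ this
      intro x hx h
      exact absurd (hx.trans_lt hz) (not_lt.2 h.1)
    · obtain ⟨w, hw, hwe⟩ := hf.exists_prim (hg.prim_nonneg hz) (hg.prim_le_one z)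
      rw [hg.measure_Iic hz, ← hwe, ← hf.measure_Iic hw.1]
      apply measure_congr
      filter_upwards [hf.ae_mem] with x hx
      apply propext
      change T x ≤ z ↔ x ≤ w
      rw [hTle x z hz, ← hwe]
      constructor
      · intro h
        by_contra hc
        push Not at hc
        have := prim_lower hf hlb hw.1 hc.le hx.2
        nlinarith [mul_pos hδ (sub_pos.2 hc)]
      · intro h
        exact hf.mono h
  have hle : W2sq f g ≤ ∫⁻ x, ENNReal.ofReal (|x - T x| ^ 2) ∂(densMeasure f) :=
    sInf_le ⟨T, hTmeas, hmap, rfl⟩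
  refine ⟨hle.trans ?_, hle.trans ?_⟩
  · calc _ ≤ ∫⁻ x, 1 ∂(densMeasure f) := by
          apply lintegral_mono_ae
          filter_upwards [hf.ae_mem] with x hx
          rw [ENNReal.ofReal_le_one, sq_le_one_iff_abs_le_one, abs_abs, abs_le]
          have := (hTmem x).1
          have := hTle1 x
          constructor <;> linarith [hx.1, hx.2]
      _ = 1 := by simp
  · rw [← hmap, lintegral_map _ hTmeas]
    · apply lintegral_mono_ae
      filter_upwards [hf.ae_mem] with x hx
      apply ENNReal.ofReal_le_ofReal
      rw [sq_abs]
      apply sq_le_sq.2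
      rw [abs_mul, abs_of_pos (inv_pos.2 hδ), le_inv_mul_iff₀ hδ]
      have hGT : prim g (T x) = prim f x := by
        apply le_antisymm _ (hTmem x).2
        obtain ⟨z, hz, hze⟩ := hg.exists_prim (hf.prim_nonneg hx.1) (hf.prim_le_one x)
        rw [← hze]
        exact hg.mono ((hTle x z hz.1).2 hze.ge)
      rw [hGT]
      rcases le_total x (T x) with h | h
      · have := prim_lower hf hlb hx.1 h (hTle1 x)
        rw [abs_of_nonpos (by linarith), abs_sub_comm]
        exact le_trans (by linarith) (this.trans (le_abs_self _))
      · have := prim_lower hf hlb (hTmem x).1 h hx.2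
        rw [abs_of_nonneg (by linarith)]
        exact this.trans (le_abs_self _)
    · have := (prim_cont hg.int).measurable
      have := (prim_cont hf.int).measurable
      fun_prop

lemma unif_prob {c : ℝ} (hc : 0 < c) : IsProbabilityMeasure (unifMeasure c) := by
  constructor
  unfold unifMeasure
  rw [Measure.smul_apply, Measure.restrict_apply_univ, Real.volume_Icc, smul_eq_mul,
    show c - -c = 2 * c by ring]
  exact ENNReal.inv_mul_cancel (by simpa using hc) ENNReal.ofReal_ne_top

lemma unif_ae {c : ℝ} : ∀ᵐ x ∂(unifMeasure c), -c < x ∧ x ≤ c := by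
  unfold unifMeasure
  refine Measure.ae_smul_measure ?_ _
  rw [← restrict_Ioc_eq_restrict_Icc]
  filter_upwards [ae_restrict_mem measurableSet_Ioc] with x hx using hx

lemma unif_mean {c : ℝ} (hc : 0 < c) : ∫ x, x ∂(unifMeasure c) = 0 := by
  unfold unifMeasure
  rw [integral_smul_measure, integral_Icc_eq_integral_Ioc,
    ← intervalIntegral.integral_of_le (by linarith), integral_id]
  simp

lemma second_moment {c : ℝ} (hc : 0 < c) {N : ℕ} (hN : 0 < N) (b : Fin N → ℝ)
    (hb : ∀ k, |b k| ≤ 1 / N) :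
    ∫⁻ r : Fin N → ℝ, ENNReal.ofReal ((∑ k, r k * b k) ^ 2)
      ∂(Measure.pi fun _ : Fin N => unifMeasure c) ≤ ENNReal.ofReal (c ^ 2) / N := by
  have := unif_prob hc
  have hNr : (0:ℝ) < N := by exact_mod_cast hN
  have hbd : ∀ k, ∀ᵐ x ∂(unifMeasure c), x * b k ∈ Icc (-(c / N)) (c / N) := by
    intro k
    filter_upwards [unif_ae (c := c)] with x hx
    rw [mem_Icc, ← abs_le, abs_mul]
    calc |x| * |b k| ≤ c * (1 / N) := by
          gcongr
          · exact abs_le.2 ⟨hx.1.le, hx.2⟩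
          · exact hb k
      _ = c / N := by ring
  have hmem : ∀ k, MemLp (fun x : ℝ => x * b k) 2 (unifMeasure c) := fun k =>
    memLp_of_bounded (hbd k) (by fun_prop) 2
  have hv := ProbabilityTheory.variance_sum_pi (μ := fun _ : Fin N => unifMeasure c)
    (X := fun k x => x * b k) hmem
  have hmem' : ∀ k, MemLp (fun r : Fin N → ℝ => r k * b k) 2
      (Measure.pi fun _ : Fin N => unifMeasure c) := fun k =>
    (hmem k).comp_measurePreserving (measurePreserving_eval _ k)
  have hmean : ∫ r : Fin N → ℝ, (∑ k, fun ω : Fin N → ℝ => ω k * b k) r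
      ∂(Measure.pi fun _ : Fin N => unifMeasure c) = 0 := by
    simp only [Finset.sum_apply]
    rw [integral_finsetSum _ (fun k _ => (hmem' k).integrable (by norm_num))]
    apply Finset.sum_eq_zero
    intro k _
    rw [integral_mul_const]
    have := (measurePreserving_eval (fun _ : Fin N => unifMeasure c) k).map_eq
    have h2 := integral_map (φ := Function.eval k) (f := fun x : ℝ => x)
      (μ := Measure.pi fun _ : Fin N => unifMeasure c) (measurable_pi_apply k).aemeasurable (by fun_prop)
    rw [this, unif_mean hc] at h2
    simp only [Function.eval] at h2
    rw [← h2, zero_mul]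
  rw [ProbabilityTheory.variance_of_integral_eq_zero (by fun_prop) hmean] at hv
  simp only [Finset.sum_apply] at hv
  have hmemS : MemLp (fun r : Fin N → ℝ => ∑ k, r k * b k) 2
      (Measure.pi fun _ : Fin N => unifMeasure c) := memLp_finsetSum _ (fun k _ => hmem' k)
  rw [← ofReal_integral_eq_lintegral_ofReal hmemS.integrable_sq
    (ae_of_all _ fun r => sq_nonneg _), hv, ← ENNReal.ofReal_natCast,
    ← ENNReal.ofReal_div_of_pos hNr]
  apply ENNReal.ofReal_le_ofReal
  calc _ ≤ ∑ k : Fin N, (c / N) ^ 2 := by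
        apply Finset.sum_le_sum
        intro k _
        refine (ProbabilityTheory.variance_le_sq_of_bounded (hbd k) (by fun_prop)).trans ?_
        apply le_of_eq
        ring
    _ = c ^ 2 / N := by
        simp
        field_simp

/-- indicator of the `k`-th cell -/
def cellFun (N : ℕ) (hN : 0 < N) (k : Fin N) : ℝ → ℝ := noiseFun N hN (Pi.single k 1)

lemma noise_meas (N : ℕ) (hN : 0 < N) (r : Fin N → ℝ) : Measurable (noiseFun N hN r) := by
  unfold noiseFun
  refine Measurable.indicator ?_ measurableSet_Ico
  have h : Measurable (fun n : ℕ => r ⟨n % N, Nat.mod_lt _ hN⟩) := measurable_from_top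
  have h2 : Measurable (fun y : ℝ => ⌊(N:ℝ) * y⌋₊) := Nat.measurable_floor.comp (by fun_prop)
  exact h.comp h2

lemma noise_supp (N : ℕ) (hN : 0 < N) (r : Fin N → ℝ) {x : ℝ} (hx : x ∉ Icc (0:ℝ) 1) :
    noiseFun N hN r x = 0 := by
  unfold noiseFun
  exact indicator_of_notMem (fun h => hx ⟨h.1, h.2.le⟩) _

lemma noise_sum (N : ℕ) (hN : 0 < N) (r : Fin N → ℝ) (x : ℝ) :
    noiseFun N hN r x = ∑ k, r k * cellFun N hN k x := by
  unfold cellFun noiseFun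
  by_cases hx : x ∈ Ico (0:ℝ) 1
  · simp [indicator_of_mem hx, Pi.single_apply]
  · simp [indicator_of_notMem hx]

lemma cell_nonneg (N : ℕ) (hN : 0 < N) (k : Fin N) (x : ℝ) : 0 ≤ cellFun N hN k x := by
  unfold cellFun noiseFun
  refine indicator_nonneg (fun y _ => ?_) _
  rw [Pi.single_apply]
  split_ifs <;> simp

lemma cell_le (N : ℕ) (hN : 0 < N) (k : Fin N) (x : ℝ) :
    cellFun N hN k x ≤ (Icc ((k:ℝ) / N) ((k + 1) / N)).indicator (fun _ => (1:ℝ)) x := by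
  have hNr : (0:ℝ) < N := by exact_mod_cast hN
  have hnn : 0 ≤ (Icc ((k:ℝ) / N) ((k + 1) / N)).indicator (fun _ => (1:ℝ)) x :=
    indicator_nonneg (fun _ _ => zero_le_one) _
  unfold cellFun noiseFun
  by_cases hx : x ∈ Ico (0:ℝ) 1
  · rw [indicator_of_mem hx, Pi.single_apply]
    split_ifs with h
    · have hNx : 0 ≤ (N:ℝ) * x := mul_nonneg hNr.le hx.1
      have hlt : ⌊(N:ℝ) * x⌋₊ < N := by
        rw [Nat.floor_lt hNx]
        nlinarith [hx.2]
      have hk : ⌊(N:ℝ) * x⌋₊ = (k : ℕ) := by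
        have := congrArg Fin.val h
        simpa [Nat.mod_eq_of_lt hlt] using this
      rw [indicator_of_mem]
      have h1 := Nat.floor_le hNx
      have h2 := Nat.lt_floor_add_one ((N:ℝ) * x)
      rw [hk] at h1 h2
      constructor
      · rw [div_le_iff₀ hNr]; linarith
      · rw [le_div_iff₀ hNr]; linarith
    · exact hnn
  · rw [indicator_of_notMem hx]
    exact hnn

lemma cell_int (N : ℕ) (hN : 0 < N) (k : Fin N) : Integrable (cellFun N hN k) := by
  have h : Integrable ((Icc ((k:ℝ) / N) ((k + 1) / N)).indicator (fun _ => (1:ℝ))) := by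
    rw [integrable_indicator_iff measurableSet_Icc]
    exact integrableOn_const (by simp)
  refine h.mono' (noise_meas _ _ _).aestronglyMeasurable (ae_of_all _ fun x => ?_)
  rw [Real.norm_of_nonneg (cell_nonneg N hN k x)]
  exact cell_le N hN k x

lemma noise_int (N : ℕ) (hN : 0 < N) (r : Fin N → ℝ) : Integrable (noiseFun N hN r) := by
  have : noiseFun N hN r = fun x => ∑ k, r k * cellFun N hN k x := funext (noise_sum N hN r)
  rw [this]
  exact integrable_finsetSum _ fun k _ => (cell_int N hN k).const_mul _

lemma cell_prim (N : ℕ) (hN : 0 < N) (k : Fin N) {z : ℝ} (hz : 0 ≤ z) :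
    0 ≤ prim (cellFun N hN k) z ∧ prim (cellFun N hN k) z ≤ 1 / N := by
  have hNr : (0:ℝ) < N := by exact_mod_cast hN
  have h : Integrable ((Icc ((k:ℝ) / N) ((k + 1) / N)).indicator (fun _ => (1:ℝ))) := by
    rw [integrable_indicator_iff measurableSet_Icc]
    exact integrableOn_const (by simp)
  refine ⟨intervalIntegral.integral_nonneg hz fun u _ => cell_nonneg N hN k u, ?_⟩
  unfold prim
  rw [intervalIntegral.integral_of_le hz]
  calc _ ≤ ∫ x, cellFun N hN k x :=
        setIntegral_le_integral (cell_int N hN k) (ae_of_all _ (cell_nonneg N hN k))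
    _ ≤ ∫ x, (Icc ((k:ℝ) / N) ((k + 1) / N)).indicator (fun _ => (1:ℝ)) x :=
        integral_mono (cell_int N hN k) h (cell_le N hN k)
    _ = 1 / N := by
        rw [integral_indicator measurableSet_Icc, setIntegral_const, smul_eq_mul, mul_one,
          Real.volume_real_Icc_of_le]
        · ring
        · gcongr; linarith

lemma noise_prim (N : ℕ) (hN : 0 < N) (r : Fin N → ℝ) (z : ℝ) :
    prim (noiseFun N hN r) z = ∑ k, r k * prim (cellFun N hN k) z := by
  unfold prim
  simp_rw [noise_sum N hN r]
  rw [intervalIntegral.integral_finsetSum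
    (fun k _ => ((cell_int N hN k).const_mul _).intervalIntegrable)]
  simp_rw [intervalIntegral.integral_const_mul]

lemma noise_bound {c : ℝ} (N : ℕ) (hN : 0 < N) (r : Fin N → ℝ)
    (hr : ∀ k, -c < r k ∧ r k ≤ c) {x : ℝ} (hx : x ∈ Ico (0:ℝ) 1) :
    -c < noiseFun N hN r x ∧ noiseFun N hN r x ≤ c := by
  unfold noiseFun
  rw [indicator_of_mem hx]
  exact hr _

lemma noise_bound' {c : ℝ} (hc : 0 < c) (N : ℕ) (hN : 0 < N) (r : Fin N → ℝ)
    (hr : ∀ k, -c < r k ∧ r k ≤ c) (x : ℝ) :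
    -c < noiseFun N hN r x ∧ noiseFun N hN r x ≤ c := by
  by_cases hx : x ∈ Ico (0:ℝ) 1
  · exact noise_bound N hN r hr hx
  · unfold noiseFun
    rw [indicator_of_notMem hx]
    exact ⟨by linarith, hc.le⟩

/-- pathwise bound -/
lemma pathwise {f : ℝ → ℝ} (hf : IsDens f) {δ : ℝ} (hδ : 0 < δ)
    (hlb : ∀ x ∈ Icc (0 : ℝ) 1, δ ≤ f x) {c : ℝ} (hc : 0 < c) (hcδ : c ≤ δ)
    (N : ℕ) (hN : 0 < N) (r : Fin N → ℝ) (hr : ∀ k, -c < r k ∧ r k ≤ c) :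
    W2sq f (noisyDensity f N hN r) ≤
      (∫⁻ z in Icc (0:ℝ) 1, ENNReal.ofReal (8 * δ⁻¹ ^ 2 * (f z + c)) *
        ENNReal.ofReal ((∑ k, r k * (prim (cellFun N hN k) z
          - prim f z * prim (cellFun N hN k) 1)) ^ 2))
      + 4 * ENNReal.ofReal ((∑ k, r k * prim (cellFun N hN k) 1) ^ 2) := by
  have hb := noise_bound' hc N hN r hr
  have hni := noise_int N hN r
  have hnn : ∀ x, 0 ≤ f x + noiseFun N hN r x := fun x => by
    by_cases hx : x ∈ Icc (0:ℝ) 1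
    · linarith [hlb x hx, (hb x).1]
    · rw [hf.supp x hx, noise_supp N hN r hx]; simp
  have hint : Integrable (fun x => f x + noiseFun N hN r x) := hf.int.add hni
  set S := ∫ y, (f y + noiseFun N hN r y) with hS
  have hSpos : 0 < S := by
    rw [hS, integral_pos_iff_support_of_nonneg hnn hint]
    refine lt_of_lt_of_le (b := volume (Ico (0:ℝ) 1)) (by simp) (measure_mono ?_)
    intro x hx
    rw [Function.mem_support]
    have := hlb x ⟨hx.1, hx.2.le⟩
    have := (hb x).1
    linarith
  have hS1 : S = 1 + prim (noiseFun N hN r) 1 := by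
    rw [hS, integral_add hf.int hni, hf.mass,
      prim_eq_one (fun x hx => noise_supp N hN r hx) le_rfl]
  have hg : IsDens (noisyDensity f N hN r) := by
    refine ⟨?_, ?_, ?_, ?_, ?_⟩
    · exact (hf.meas.add (noise_meas N hN r)).div_const _
    · exact fun x => div_nonneg (hnn x) hSpos.le
    · intro x hx
      unfold noisyDensity
      rw [hf.supp x hx, noise_supp N hN r hx]; simp
    · exact hint.div_const _
    · unfold noisyDensity
      rw [integral_div, ← hS, div_self hSpos.ne']
  obtain ⟨h1, h2⟩ := transport hf hg hδ hlb
  rcases lt_or_ge S (1/2) with hS2 | hS2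
  · refine le_trans (h1.trans ?_) le_add_self
    rw [← noise_prim]
    have : (1:ℝ) ≤ 4 * prim (noiseFun N hN r) 1 ^ 2 := by
      have : prim (noiseFun N hN r) 1 < -(1/2) := by linarith
      nlinarith
    calc (1:ℝ≥0∞) = ENNReal.ofReal 1 := by simp
      _ ≤ ENNReal.ofReal (4 * prim (noiseFun N hN r) 1 ^ 2) := ENNReal.ofReal_le_ofReal this
      _ = _ := by rw [ENNReal.ofReal_mul (by norm_num)]; simp
  · refine le_trans (h2.trans ?_) le_self_add
    unfold densMeasure
    have m1 := (prim_cont hg.int).measurable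
    have m2 := (prim_cont hf.int).measurable
    rw [lintegral_withDensity_eq_lintegral_mul _ hg.meas.ennreal_ofReal (by fun_prop),
      ← lintegral_indicator measurableSet_Icc]
    apply lintegral_mono
    intro z
    by_cases hz : z ∈ Icc (0:ℝ) 1
    · rw [indicator_of_mem hz]
      have hG : prim (noisyDensity f N hN r) z = (prim f z + prim (noiseFun N hN r) z) / S := by
        unfold prim noisyDensity
        rw [intervalIntegral.integral_div, intervalIntegral.integral_add
          hf.int.intervalIntegrable hni.intervalIntegrable]
      have hsum : ∑ k, r k * (prim (cellFun N hN k) z - prim f z * prim (cellFun N hN k) 1)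
          = prim (noiseFun N hN r) z - prim f z * prim (noiseFun N hN r) 1 := by
        rw [noise_prim, noise_prim, Finset.mul_sum, ← Finset.sum_sub_distrib]
        exact Finset.sum_congr rfl fun k _ => by ring
      rw [hsum]
      set D := prim (noiseFun N hN r) z - prim f z * prim (noiseFun N hN r) 1 with hD
      have hGF : prim (noisyDensity f N hN r) z - prim f z = D / S := by
        rw [hG, hD, div_sub' hSpos.ne', hS1]
        ring
      simp only [Pi.mul_apply]
      rw [hGF, ← ENNReal.ofReal_mul (hg.nonneg z), ← ENNReal.ofReal_mul (by
        have := hf.nonneg z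
        positivity)]
      apply ENNReal.ofReal_le_ofReal
      have hgz : noisyDensity f N hN r z ≤ (f z + c) * 2 := by
        unfold noisyDensity
        rw [← hS, div_le_iff₀ hSpos]
        have := hf.nonneg z
        nlinarith [(hb z).2]
      have hDS : (δ⁻¹ * (D / S)) ^ 2 ≤ δ⁻¹ ^ 2 * (4 * D ^ 2) := by
        rw [mul_pow]
        gcongr
        rw [div_pow, div_le_iff₀ (by positivity)]
        nlinarith [sq_nonneg D, mul_nonneg (sq_nonneg D) (show 0 ≤ 4 * S ^ 2 - 1 by nlinarith)]
      calc _ ≤ ((f z + c) * 2) * (δ⁻¹ ^ 2 * (4 * D ^ 2)) := by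
            have := hf.nonneg z
            gcongr
        _ = _ := by ring
    · rw [indicator_of_notMem hz]
      simp [hg.supp z hz]

theorem W2sq_noise_insensitivity
    (f : ℝ → ℝ) (hf_meas : Measurable f)
    (hf_supp : ∀ x, x ∉ Icc (0 : ℝ) 1 → f x = 0)
    (δ : ℝ) (hδ : 0 < δ) (hf_lb : ∀ x ∈ Icc (0 : ℝ) 1, δ ≤ f x)
    (hf_mass : ∫⁻ x, ENNReal.ofReal (f x) = 1)
    (c : ℝ) (hc : 0 < c) (hcδ : c ≤ δ) :
    ∃ C : ℝ≥0∞, C ≠ ⊤ ∧ ∀ (N : ℕ) (hN : 0 < N),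
      (∫⁻ r : Fin N → ℝ, W2sq f (noisyDensity f N hN r)
          ∂(Measure.pi fun _ : Fin N => unifMeasure c)) ≤ C / N := by
  have hnn : ∀ x, 0 ≤ f x := fun x => by
    by_cases hx : x ∈ Icc (0:ℝ) 1
    · exact hδ.le.trans (hf_lb x hx)
    · rw [hf_supp x hx]
  have hint : Integrable f := by
    refine ⟨hf_meas.aestronglyMeasurable, ?_⟩
    rw [hasFiniteIntegral_iff_ofReal (ae_of_all _ hnn), hf_mass]
    exact ENNReal.one_lt_top
  have hf : IsDens f := by
    refine ⟨hf_meas, hnn, hf_supp, hint, ?_⟩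
    rw [integral_eq_lintegral_of_nonneg_ae (ae_of_all _ hnn) hf_meas.aestronglyMeasurable,
      hf_mass]
    simp
  have := unif_prob hc
  set A : ℝ≥0∞ := ∫⁻ z in Icc (0:ℝ) 1, ENNReal.ofReal (8 * δ⁻¹ ^ 2 * (f z + c)) with hA
  have hAfin : A ≠ ⊤ := by
    have : IntegrableOn (fun z => 8 * δ⁻¹ ^ 2 * (f z + c)) (Icc (0:ℝ) 1) :=
      (hint.integrableOn.add (integrableOn_const (by simp))).const_mul _
    exact this.lintegral_lt_top.ne
  refine ⟨A * ENNReal.ofReal (c ^ 2) + 4 * ENNReal.ofReal (c ^ 2), by finiteness, ?_⟩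
  intro N hN
  have hrae : ∀ᵐ r ∂(Measure.pi fun _ : Fin N => unifMeasure c), ∀ k, -c < r k ∧ r k ≤ c := by
    rw [ae_all_iff]
    intro k
    exact (Measure.quasiMeasurePreserving_eval (fun _ : Fin N => unifMeasure c) k).ae unif_ae
  have mf := (prim_cont hint).measurable
  have mc : ∀ k, Measurable (prim (cellFun N hN k)) := fun k =>
    (prim_cont (cell_int N hN k)).measurable
  have hmeas : Measurable (Function.uncurry fun (r : Fin N → ℝ) (z : ℝ) =>
      ENNReal.ofReal (8 * δ⁻¹ ^ 2 * (f z + c)) *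
        ENNReal.ofReal ((∑ k, r k * (prim (cellFun N hN k) z
          - prim f z * prim (cellFun N hN k) 1)) ^ 2)) := by
    unfold Function.uncurry
    fun_prop
  calc _ ≤ ∫⁻ r : Fin N → ℝ, ((∫⁻ z in Icc (0:ℝ) 1, ENNReal.ofReal (8 * δ⁻¹ ^ 2 * (f z + c)) *
        ENNReal.ofReal ((∑ k, r k * (prim (cellFun N hN k) z
          - prim f z * prim (cellFun N hN k) 1)) ^ 2))
      + 4 * ENNReal.ofReal ((∑ k, r k * prim (cellFun N hN k) 1) ^ 2))
          ∂(Measure.pi fun _ : Fin N => unifMeasure c) := by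
        apply lintegral_mono_ae
        filter_upwards [hrae] with r hr
        exact pathwise hf hδ hf_lb hc hcδ N hN r hr
    _ = (∫⁻ z in Icc (0:ℝ) 1, ∫⁻ r : Fin N → ℝ, ENNReal.ofReal (8 * δ⁻¹ ^ 2 * (f z + c)) *
        ENNReal.ofReal ((∑ k, r k * (prim (cellFun N hN k) z
          - prim f z * prim (cellFun N hN k) 1)) ^ 2)
            ∂(Measure.pi fun _ : Fin N => unifMeasure c))
      + 4 * ∫⁻ r : Fin N → ℝ, ENNReal.ofReal ((∑ k, r k * prim (cellFun N hN k) 1) ^ 2)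
          ∂(Measure.pi fun _ : Fin N => unifMeasure c) := by
        rw [lintegral_add_right _ (by fun_prop), lintegral_const_mul _ (by fun_prop),
          lintegral_lintegral_swap hmeas.aemeasurable]
    _ ≤ (∫⁻ z in Icc (0:ℝ) 1, ENNReal.ofReal (8 * δ⁻¹ ^ 2 * (f z + c)) *
          (ENNReal.ofReal (c ^ 2) / N)) + 4 * (ENNReal.ofReal (c ^ 2) / N) := by
        gcongr ?_ + 4 * ?_
        · apply setLIntegral_mono' measurableSet_Icc
          intro z hz
          rw [lintegral_const_mul _ (by fun_prop)]
          gcongr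
          apply second_moment hc hN
          intro k
          obtain ⟨a1, a2⟩ := cell_prim N hN k hz.1
          obtain ⟨b1, b2⟩ := cell_prim N hN k zero_le_one
          have p0 := hf.prim_nonneg hz.1
          have p1 := hf.prim_le_one z
          rw [abs_le]
          constructor <;> nlinarith
        · apply second_moment hc hN
          intro k
          obtain ⟨b1, b2⟩ := cell_prim N hN k zero_le_one
          rw [abs_of_nonneg b1]
          exact b2
    _ = _ := by
        rw [lintegral_mul_const _ (by fun_prop), ← hA, ← mul_div_assoc, ← mul_div_assoc,
          ENNReal.add_div]
end
end
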